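/- Suppose g'(u) ≠ 0 for all u ∈ I and the meridian surface M² has pointwise 1-type Gauss map of the second kind (ΔG = λ(G + C) with λ smooth nowhere zero and C a nonzero constant bivector). Then one of the following holds: (i) κ is constant, κ_α ≡ 0, and f(u) = a u + a₁, g(u) = b u + b₁ for constants a, a₁, b, b₁ with a² + b² = 1 and a ≠ 0, b ≠ 0; or (ii) κ ≡ 0 and f satisfies the differential equation (ln[ −√(1 − f'²)( f(1 − f'²)(f f'')' + f² f' f''² + f'(1 − f'²)² ) / ( f f'(f f'')'(1 − f'²) + f² f''² + (1 − f'²)² ) ])' = −f' f''/(1 − f'²). -/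

import Mathlib

open Matrix

noncomputable section

/-- The embedding of `ℝ³ = span{e₁,e₂,e₃}` into `ℝ⁴`. -/
def emb (p : Fin 3 → ℝ) : Fin 4 → ℝ := ![p 0, p 1, p 2, 0]

/-- The fourth standard basis vector `e₄` of `ℝ⁴`. -/
def e4 : Fin 4 → ℝ := ![0, 0, 0, 1]

/-- Model of the bivector `a ∧ b ∈ Λ²ℝ⁴` as the antisymmetric matrix `aᵢbⱼ − aⱼbᵢ`. -/
def wedge (a b : Fin 4 → ℝ) : Fin 4 → Fin 4 → ℝ := fun i j => a i * b j - a j * b i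

/-- The tangent `t = r'` of the spherical curve `r`. -/
def sphT (r : ℝ → Fin 3 → ℝ) : ℝ → Fin 3 → ℝ := deriv r

/-- The normal `n = r × t` of the spherical curve `r`. -/
def sphN (r : ℝ → Fin 3 → ℝ) (v : ℝ) : Fin 3 → ℝ := crossProduct (r v) (deriv r v)

/-- The spherical curvature `κ = ⟨t', n⟩` of the spherical curve `r`. -/
def sphCurv (r : ℝ → Fin 3 → ℝ) (v : ℝ) : ℝ := deriv (deriv r) v ⬝ᵥ sphN r v

/-- The curvature `κ_α = f′g″ − g′f″` of the meridian curve `α = (f, g)`. -/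
def merCurv (f g : ℝ → ℝ) (u : ℝ) : ℝ :=
  deriv f u * deriv (deriv g) u - deriv g u * deriv (deriv f) u

/-- The parametrization `z(u,v) = f(u) r(v) + g(u) e₄` of the meridian surface `M²`. -/
def mz (f g : ℝ → ℝ) (r : ℝ → Fin 3 → ℝ) (u v : ℝ) : Fin 4 → ℝ :=
  f u • emb (r v) + g u • e4

/-- The tangent frame vector `x = ∂z/∂u = f′ r + g′ e₄`. -/
def mx (f g : ℝ → ℝ) (r : ℝ → Fin 3 → ℝ) (u v : ℝ) : Fin 4 → ℝ :=
  deriv f u • emb (r v) + deriv g u • e4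

/-- The tangent frame vector `y = (1/f) ∂z/∂v = t`. -/
def my (r : ℝ → Fin 3 → ℝ) (v : ℝ) : Fin 4 → ℝ := emb (deriv r v)

/-- The normal frame vector `n₁ = n`. -/
def mn1 (r : ℝ → Fin 3 → ℝ) (v : ℝ) : Fin 4 → ℝ := emb (sphN r v)

/-- The normal frame vector `n₂ = −g′ r + f′ e₄`. -/
def mn2 (f g : ℝ → ℝ) (r : ℝ → Fin 3 → ℝ) (u v : ℝ) : Fin 4 → ℝ :=
  (-(deriv g u)) • emb (r v) + deriv f u • e4

/-- The Gauss map `G = x ∧ y` of the meridian surface, with values in `Λ²ℝ⁴`. -/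
def gaussG (f g : ℝ → ℝ) (r : ℝ → Fin 3 → ℝ) (u v : ℝ) : Fin 4 → Fin 4 → ℝ :=
  wedge (mx f g r u v) (my r v)

/-- The Laplacian `Δφ = −(∂²φ/∂u² + (1/f²) ∂²φ/∂v² + (f′/f) ∂φ/∂u)` of the meridian
surface, acting on `Λ²ℝ⁴`-valued functions. -/
def surfLap (f : ℝ → ℝ) (φ : ℝ → ℝ → Fin 4 → Fin 4 → ℝ) (u v : ℝ) : Fin 4 → Fin 4 → ℝ :=
  -(deriv (deriv (fun s => φ s v)) u + (1 / f u ^ 2) • deriv (deriv (fun s => φ u s)) v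
    + (deriv f u / f u) • deriv (fun s => φ s v) u)

/-- `h(x,x)`: the normal component (w.r.t. `{n₁, n₂}`) of `∇′ₓx = ∂x/∂u`. -/
def hxx (f g : ℝ → ℝ) (r : ℝ → Fin 3 → ℝ) (u v : ℝ) : Fin 4 → ℝ :=
  (deriv (fun s => mx f g r s v) u ⬝ᵥ mn1 r v) • mn1 r v
    + (deriv (fun s => mx f g r s v) u ⬝ᵥ mn2 f g r u v) • mn2 f g r u v

/-- `h(x,y)`: the normal component (w.r.t. `{n₁, n₂}`) of `∇′_y x = (1/f) ∂x/∂v`. -/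
def hxy (f g : ℝ → ℝ) (r : ℝ → Fin 3 → ℝ) (u v : ℝ) : Fin 4 → ℝ :=
  (((1 / f u) • deriv (fun s => mx f g r u s) v) ⬝ᵥ mn1 r v) • mn1 r v
    + (((1 / f u) • deriv (fun s => mx f g r u s) v) ⬝ᵥ mn2 f g r u v) • mn2 f g r u v

/-- `h(y,y)`: the normal component (w.r.t. `{n₁, n₂}`) of `∇′_y y = (1/f) ∂y/∂v`. -/
def hyy (f g : ℝ → ℝ) (r : ℝ → Fin 3 → ℝ) (u v : ℝ) : Fin 4 → ℝ :=
  (((1 / f u) • deriv (my r) v) ⬝ᵥ mn1 r v) • mn1 r v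
    + (((1 / f u) • deriv (my r) v) ⬝ᵥ mn2 f g r u v) • mn2 f g r u v


theorem ContDiffOn.hasDerivAt_deriv_of_isOpen {E : Type*} [NormedAddCommGroup E] [NormedSpace ℝ E]
    {s : Set ℝ} {φ : ℝ → E} (hφ : ContDiffOn ℝ (⊤ : ℕ∞) φ s) (hs : IsOpen s) {x : ℝ}
    (hx : x ∈ s) : HasDerivAt φ (deriv φ x) x :=
  ((hφ.differentiableOn (by simp)).differentiableAt (hs.mem_nhds hx)).hasDerivAt

theorem ContDiffOn.deriv_top_of_isOpen {E : Type*} [NormedAddCommGroup E] [NormedSpace ℝ E]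
    {s : Set ℝ} {φ : ℝ → E} (hφ : ContDiffOn ℝ (⊤ : ℕ∞) φ s) (hs : IsOpen s) :
    ContDiffOn ℝ (⊤ : ℕ∞) (deriv φ) s :=
  hφ.deriv_of_isOpen hs (by simp)

theorem exists_eq_const_of_hasDerivAt_zero {s : Set ℝ} (hs : IsOpen s) (hsc : s.OrdConnected)
    {φ : ℝ → ℝ} (h : ∀ x ∈ s, HasDerivAt φ 0 x) : ∃ c, ∀ x ∈ s, φ x = c :=
  hs.exists_is_const_of_deriv_eq_zero hsc.isPreconnected
    (fun x hx => (h x hx).differentiableAt.differentiableWithinAt) fun x hx => (h x hx).deriv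

/-- The derivative of a function which is constant on an open set vanishes there. -/
theorem HasDerivAt.eq_zero_of_eq_const {s : Set ℝ} (hs : IsOpen s) {φ : ℝ → ℝ} {φ' c x : ℝ}
    (hφ : HasDerivAt φ φ' x) (hx : x ∈ s) (hc : ∀ y ∈ s, φ y = c) : φ' = 0 :=
  hφ.unique ((hasDerivAt_const x c).congr_of_eventuallyEq
    (Filter.eventually_of_mem (hs.mem_nhds hx) hc))

/-- The second derivative, from a formula for the first one on an open set. -/
theorem deriv_deriv_eq_of_hasDerivAt {E : Type*} [NormedAddCommGroup E] [NormedSpace ℝ E]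
    {s : Set ℝ} (hs : IsOpen s) {φ φ₁ : ℝ → E} {φ₂ : E} {x : ℝ} (hx : x ∈ s)
    (h₁ : ∀ y ∈ s, HasDerivAt φ (φ₁ y) y) (h₂ : HasDerivAt φ₁ φ₂ x) :
    deriv (deriv φ) x = φ₂ :=
  (h₂.congr_of_eventuallyEq
    (Filter.eventually_of_mem (hs.mem_nhds hx) fun y hy => (h₁ y hy).deriv)).deriv

theorem HasDerivAt.dotProduct_fin_three {a b : ℝ → Fin 3 → ℝ} {a' b' : Fin 3 → ℝ} {x : ℝ}
    (ha : HasDerivAt a a' x) (hb : HasDerivAt b b' x) :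
    HasDerivAt (fun s => a s ⬝ᵥ b s) (a' ⬝ᵥ b x + a x ⬝ᵥ b') x := by
  rw [hasDerivAt_pi] at ha hb
  simp only [dotProduct, ← Finset.sum_add_distrib]
  exact HasDerivAt.fun_sum fun i _ => (ha i).mul (hb i)

theorem HasDerivAt.const_dotProduct_fin_three {b : ℝ → Fin 3 → ℝ} {b' : Fin 3 → ℝ} {x : ℝ}
    (w : Fin 3 → ℝ) (hb : HasDerivAt b b' x) :
    HasDerivAt (fun s => w ⬝ᵥ b s) (w ⬝ᵥ b') x := by
  simpa using (hasDerivAt_const x w).dotProduct_fin_three hb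

theorem HasDerivAt.crossProduct {a b : ℝ → Fin 3 → ℝ} {a' b' : Fin 3 → ℝ} {x : ℝ}
    (ha : HasDerivAt a a' x) (hb : HasDerivAt b b' x) :
    HasDerivAt (fun s => crossProduct (a s) (b s))
      (crossProduct a' (b x) + crossProduct (a x) b') x := by
  rw [hasDerivAt_pi] at ha hb ⊢
  intro i
  fin_cases i
  · refine (((ha 1).mul (hb 2)).sub ((ha 2).mul (hb 1))).congr_deriv ?_
    simp [cross_apply]; ring
  · refine (((ha 2).mul (hb 0)).sub ((ha 0).mul (hb 2))).congr_deriv ?_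
    simp [cross_apply]; ring
  · refine (((ha 0).mul (hb 1)).sub ((ha 1).mul (hb 0))).congr_deriv ?_
    simp [cross_apply]; ring

theorem cross_dotProduct_self_of_orthonormal {p q : Fin 3 → ℝ} (hp : p ⬝ᵥ p = 1)
    (hq : q ⬝ᵥ q = 1) (hpq : p ⬝ᵥ q = 0) : crossProduct p q ⬝ᵥ crossProduct p q = 1 := by
  rw [cross_dot_cross, hp, hq, hpq]; ring

/-- Expansion of a vector of `ℝ³` in the orthonormal basis `p, q, p × q`. -/
theorem eq_dotProduct_smul_add_of_orthonormal {p q : Fin 3 → ℝ} (hp : p ⬝ᵥ p = 1)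
    (hq : q ⬝ᵥ q = 1) (hpq : p ⬝ᵥ q = 0) (w : Fin 3 → ℝ) :
    w = (w ⬝ᵥ p) • p + (w ⬝ᵥ q) • q + (w ⬝ᵥ crossProduct p q) • crossProduct p q := by
  have key : ((p ⬝ᵥ p) * (q ⬝ᵥ q) - (p ⬝ᵥ q) ^ 2) • w =
      (w ⬝ᵥ p) • ((q ⬝ᵥ q) • p - (p ⬝ᵥ q) • q) + (w ⬝ᵥ q) • ((p ⬝ᵥ p) • q - (p ⬝ᵥ q) • p)
        + (w ⬝ᵥ crossProduct p q) • crossProduct p q := by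
    ext i
    fin_cases i <;> simp [cross_apply, dotProduct, Fin.sum_univ_three] <;> ring
  simpa [hp, hq, hpq] using key

section Frenet

variable {J : Set ℝ} {r : ℝ → Fin 3 → ℝ}

theorem dotProduct_deriv_eq_zero (hJ : IsOpen J) (hr : ContDiffOn ℝ (⊤ : ℕ∞) r J)
    (hrs : ∀ v ∈ J, r v ⬝ᵥ r v = 1) {v : ℝ} (hv : v ∈ J) : r v ⬝ᵥ deriv r v = 0 := by
  have h := hr.hasDerivAt_deriv_of_isOpen hJ hv
  have h0 := (h.dotProduct_fin_three h).eq_zero_of_eq_const hJ hv hrs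
  rw [dotProduct_comm (deriv r v)] at h0
  linarith

theorem deriv_deriv_eq_neg_add_sphCurv_smul (hJ : IsOpen J) (hr : ContDiffOn ℝ (⊤ : ℕ∞) r J)
    (hrs : ∀ v ∈ J, r v ⬝ᵥ r v = 1) (hra : ∀ v ∈ J, deriv r v ⬝ᵥ deriv r v = 1)
    {v : ℝ} (hv : v ∈ J) : deriv (deriv r) v = -r v + sphCurv r v • sphN r v := by
  have h₁ := hr.hasDerivAt_deriv_of_isOpen hJ hv
  have h₂ := (hr.deriv_top_of_isOpen hJ).hasDerivAt_deriv_of_isOpen hJ hv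
  have hrt : ∀ w ∈ J, r w ⬝ᵥ deriv r w = 0 := fun w => dotProduct_deriv_eq_zero hJ hr hrs
  have hst := dotProduct_deriv_eq_zero hJ (hr.deriv_top_of_isOpen hJ) hra hv
  have hsr := (h₁.dotProduct_fin_three h₂).eq_zero_of_eq_const hJ hv hrt
  rw [hra v hv, dotProduct_comm] at hsr
  rw [dotProduct_comm] at hst
  rw [eq_dotProduct_smul_add_of_orthonormal (hrs v hv) (hra v hv) (hrt v hv) (deriv (deriv r) v),
    hst, show deriv (deriv r) v ⬝ᵥ r v = -1 by linarith]
  simp [sphCurv, sphN]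

theorem hasDerivAt_deriv_sphere (hJ : IsOpen J) (hr : ContDiffOn ℝ (⊤ : ℕ∞) r J)
    (hrs : ∀ v ∈ J, r v ⬝ᵥ r v = 1) (hra : ∀ v ∈ J, deriv r v ⬝ᵥ deriv r v = 1)
    {v : ℝ} (hv : v ∈ J) : HasDerivAt (deriv r) (-r v + sphCurv r v • sphN r v) v :=
  deriv_deriv_eq_neg_add_sphCurv_smul hJ hr hrs hra hv ▸
    (hr.deriv_top_of_isOpen hJ).hasDerivAt_deriv_of_isOpen hJ hv

theorem hasDerivAt_sphN (hJ : IsOpen J) (hr : ContDiffOn ℝ (⊤ : ℕ∞) r J)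
    (hrs : ∀ v ∈ J, r v ⬝ᵥ r v = 1) (hra : ∀ v ∈ J, deriv r v ⬝ᵥ deriv r v = 1)
    {v : ℝ} (hv : v ∈ J) : HasDerivAt (sphN r) (-sphCurv r v • deriv r v) v := by
  refine ((hr.hasDerivAt_deriv_of_isOpen hJ hv).crossProduct
    (hasDerivAt_deriv_sphere hJ hr hrs hra hv)).congr_deriv ?_
  have hrrt : crossProduct (r v) (sphN r v) = -deriv r v := by
    have key : crossProduct (r v) (sphN r v) =
        (r v ⬝ᵥ deriv r v) • r v - (r v ⬝ᵥ r v) • deriv r v := by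
      ext i
      fin_cases i <;> simp [sphN, cross_apply, dotProduct, Fin.sum_univ_three] <;> ring
    simpa [dotProduct_deriv_eq_zero hJ hr hrs hv, hrs v hv] using key
  simp [hrrt]

theorem hasDerivAt_sphCurv (hJ : IsOpen J) (hr : ContDiffOn ℝ (⊤ : ℕ∞) r J)
    (hrs : ∀ v ∈ J, r v ⬝ᵥ r v = 1) (hra : ∀ v ∈ J, deriv r v ⬝ᵥ deriv r v = 1)
    {v : ℝ} (hv : v ∈ J) : HasDerivAt (sphCurv r) (deriv (sphCurv r) v) v :=
  ((((hr.deriv_top_of_isOpen hJ).deriv_top_of_isOpen hJ).hasDerivAt_deriv_of_isOpen hJ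
    hv).dotProduct_fin_three (hasDerivAt_sphN hJ hr hrs hra hv)).differentiableAt.hasDerivAt

end Frenet

/-- The bivector `∗b + e₄ ∧ d` of `ℝ⁴`, where `∗` is the Hodge star of `ℝ³`. -/
def bivector : (Fin 3 → ℝ) × (Fin 3 → ℝ) →ₗ[ℝ] Fin 4 → Fin 4 → ℝ where
  toFun w := ![![0, w.1 2, -w.1 1, -w.2 0], ![-w.1 2, 0, w.1 0, -w.2 1],
    ![w.1 1, -w.1 0, 0, -w.2 2], ![w.2 0, w.2 1, w.2 2, 0]]
  map_add' w w' := by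
    ext i j
    fin_cases i <;> fin_cases j <;> simp <;> ring
  map_smul' c w := by
    ext i j
    fin_cases i <;> fin_cases j <;> simp

theorem bivector_injective : Function.Injective bivector := by
  rw [injective_iff_map_eq_zero]
  rintro ⟨b, d⟩ h
  have e := fun i j => congrFun (congrFun h i) j
  ext i
  · fin_cases i
    · simpa [bivector] using e 1 2
    · simpa [bivector] using e 2 0
    · simpa [bivector] using e 0 1
  · fin_cases i
    · simpa [bivector] using e 3 0
    · simpa [bivector] using e 3 1
    · simpa [bivector] using e 3 2

theorem exists_bivector_eq {C : Fin 4 → Fin 4 → ℝ} (hC : ∀ i j, C i j = -C j i) :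
    ∃ b d, bivector (b, d) = C := by
  refine ⟨![C 1 2, C 2 0, C 0 1], ![C 3 0, C 3 1, C 3 2], ?_⟩
  ext i j
  have hd : ∀ i, C i i = 0 := fun i => by linarith [hC i i]
  fin_cases i <;> fin_cases j <;> simp [bivector, hd] <;> linarith [hC 0 1, hC 0 2, hC 0 3,
    hC 1 2, hC 1 3, hC 2 3]

theorem gaussG_eq_bivector (f g : ℝ → ℝ) (r : ℝ → Fin 3 → ℝ) (u v : ℝ) :
    gaussG f g r u v = bivector (deriv f u • sphN r v, deriv g u • deriv r v) := by
  ext i j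
  fin_cases i <;> fin_cases j <;>
    simp [gaussG, wedge, mx, my, emb, e4, bivector, sphN, cross_apply] <;> ring

theorem HasDerivAt.bivector {φ : ℝ → (Fin 3 → ℝ) × (Fin 3 → ℝ)} {φ' : (Fin 3 → ℝ) × (Fin 3 → ℝ)}
    {x : ℝ} (h : HasDerivAt φ φ' x) : HasDerivAt (fun s => bivector (φ s)) (bivector φ') x :=
  (LinearMap.toContinuousLinearMap _root_.bivector).hasFDerivAt.comp_hasDerivAt x h

theorem surfLap_gaussG {I J : Set ℝ} (hI : IsOpen I) (hJ : IsOpen J) {r : ℝ → Fin 3 → ℝ}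
    (hr : ContDiffOn ℝ (⊤ : ℕ∞) r J) (hrs : ∀ v ∈ J, r v ⬝ᵥ r v = 1)
    (hra : ∀ v ∈ J, deriv r v ⬝ᵥ deriv r v = 1) {f g : ℝ → ℝ}
    (hf : ContDiffOn ℝ (⊤ : ℕ∞) f I) (hg : ContDiffOn ℝ (⊤ : ℕ∞) g I)
    {u v : ℝ} (hu : u ∈ I) (hv : v ∈ J) :
    surfLap f (gaussG f g r) u v = bivector
      (-((deriv (deriv (deriv f)) u + deriv f u / f u * deriv (deriv f) u) • sphN r v
          + (deriv f u / f u ^ 2) • (sphCurv r v • r v - deriv (sphCurv r) v • deriv r v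
            - sphCurv r v ^ 2 • sphN r v)),
        -((deriv (deriv (deriv g)) u + deriv f u / f u * deriv (deriv g) u) • deriv r v
          + (deriv g u / f u ^ 2) • (deriv (sphCurv r) v • sphN r v
            - (1 + sphCurv r v ^ 2) • deriv r v))) := by
  have hd {φ : ℝ → ℝ} (hφ : ContDiffOn ℝ (⊤ : ℕ∞) φ I) {s : ℝ} (hs : s ∈ I) :
      HasDerivAt (deriv φ) (deriv (deriv φ) s) s :=
    (hφ.deriv_top_of_isOpen hI).hasDerivAt_deriv_of_isOpen hI hs
  have hd' {φ : ℝ → ℝ} (hφ : ContDiffOn ℝ (⊤ : ℕ∞) φ I) {s : ℝ} (hs : s ∈ I) :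
      HasDerivAt (deriv (deriv φ)) (deriv (deriv (deriv φ)) s) s :=
    hd (hφ.deriv_top_of_isOpen hI) hs
  have hN {s : ℝ} (hs : s ∈ J) := hasDerivAt_sphN hJ hr hrs hra hs
  have hT {s : ℝ} (hs : s ∈ J) := hasDerivAt_deriv_sphere hJ hr hrs hra hs
  have hκ := hasDerivAt_sphCurv hJ hr hrs hra hv
  have hu₁ : ∀ s ∈ I, HasDerivAt (fun s => gaussG f g r s v)
      (bivector (deriv (deriv f) s • sphN r v, deriv (deriv g) s • deriv r v)) s := fun s hs => by
    simp only [gaussG_eq_bivector]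
    exact (((hd hf hs).smul_const _).prodMk ((hd hg hs).smul_const _)).bivector
  have hu₂ := deriv_deriv_eq_of_hasDerivAt hI hu hu₁
    (((hd' hf hu).smul_const _).prodMk ((hd' hg hu).smul_const _)).bivector
  have hv₁ : ∀ s ∈ J, HasDerivAt (fun s => gaussG f g r u s)
      (bivector (deriv f u • (-sphCurv r s • deriv r s),
        deriv g u • (-r s + sphCurv r s • sphN r s))) s := fun s hs => by
    simp only [gaussG_eq_bivector]
    exact (((hN hs).const_smul (deriv f u)).prodMk ((hT hs).const_smul (deriv g u))).bivector
  have hv₂ := deriv_deriv_eq_of_hasDerivAt hJ hv hv₁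
    (((hκ.neg.smul (hT hv)).const_smul (deriv f u)).prodMk
      (((hr.hasDerivAt_deriv_of_isOpen hJ hv).neg.add (hκ.smul (hN hv))).const_smul
        (deriv g u))).bivector
  rw [surfLap, hu₂, hv₂, (hu₁ u hu).deriv, ← map_smul, ← map_smul, ← map_add, ← map_add, ← map_neg]
  congr 1
  ext i <;> simp <;> ring

/-- The pointwise 1-type equation of the second kind, written in the frame of the meridian
surface: `κ` is a constant `k`, and `C` is determined by `k` and a nonzero constant `c`. -/
theorem exists_frame_equations {I J : Set ℝ} (hI : IsOpen I) (hIne : I.Nonempty)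
    (hJ : IsOpen J) (hJiv : J.OrdConnected) (hJne : J.Nonempty) {r : ℝ → Fin 3 → ℝ}
    (hr : ContDiffOn ℝ (⊤ : ℕ∞) r J) (hrs : ∀ v ∈ J, r v ⬝ᵥ r v = 1)
    (hra : ∀ v ∈ J, deriv r v ⬝ᵥ deriv r v = 1) {f g : ℝ → ℝ}
    (hf : ContDiffOn ℝ (⊤ : ℕ∞) f I) (hg : ContDiffOn ℝ (⊤ : ℕ∞) g I)
    (hf0 : ∀ u ∈ I, f u ≠ 0) (hg' : ∀ u ∈ I, deriv g u ≠ 0) {lam : ℝ → ℝ → ℝ}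
    (hlam0 : ∀ u ∈ I, ∀ v ∈ J, lam u v ≠ 0)
    {C : Fin 4 → Fin 4 → ℝ} (hCskew : ∀ i j, C i j = -C j i) (hC0 : C ≠ 0)
    (heq : ∀ u ∈ I, ∀ v ∈ J,
      surfLap f (gaussG f g r) u v = lam u v • (gaussG f g r u v + C)) :
    ∃ k c : ℝ, c ≠ 0 ∧ (∀ v ∈ J, sphCurv r v = k) ∧ ∀ u ∈ I, ∀ v ∈ J,
      -(deriv f u / f u ^ 2 * k) = lam u v * (k * c) ∧
      -(deriv (deriv (deriv f)) u + deriv f u / f u * deriv (deriv f) u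
        - deriv f u / f u ^ 2 * k ^ 2) = lam u v * (deriv f u + c) ∧
      -(deriv (deriv (deriv g)) u + deriv f u / f u * deriv (deriv g) u
        - deriv g u / f u ^ 2 * (1 + k ^ 2)) = lam u v * deriv g u := by
  obtain ⟨b, d, rfl⟩ := exists_bivector_eq hCskew
  obtain ⟨u₀, hu₀⟩ := hIne
  obtain ⟨v₀, hv₀⟩ := hJne
  have hrt : ∀ v ∈ J, r v ⬝ᵥ deriv r v = 0 := fun v => dotProduct_deriv_eq_zero hJ hr hrs
  have htr : ∀ v ∈ J, deriv r v ⬝ᵥ r v = 0 := fun v hv => by rw [dotProduct_comm, hrt v hv]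
  have hrn : ∀ v, r v ⬝ᵥ sphN r v = 0 := fun v => dot_self_cross _ _
  have hnr : ∀ v, sphN r v ⬝ᵥ r v = 0 := fun v => by rw [dotProduct_comm, hrn]
  have htn : ∀ v, deriv r v ⬝ᵥ sphN r v = 0 := fun v => dot_cross_self _ _
  have hnt : ∀ v, sphN r v ⬝ᵥ deriv r v = 0 := fun v => by rw [dotProduct_comm, htn]
  have hnn : ∀ v ∈ J, sphN r v ⬝ᵥ sphN r v = 1 := fun v hv =>
    cross_dotProduct_self_of_orthonormal (hrs v hv) (hra v hv) (hrt v hv)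
  have hexp : ∀ v ∈ J, ∀ w : Fin 3 → ℝ,
      w = (w ⬝ᵥ r v) • r v + (w ⬝ᵥ deriv r v) • deriv r v + (w ⬝ᵥ sphN r v) • sphN r v :=
    fun v hv => eq_dotProduct_smul_add_of_orthonormal (hrs v hv) (hra v hv) (hrt v hv)
  have hvec : ∀ u ∈ I, ∀ v ∈ J, _ ∧ _ := fun u hu v hv => by
    have h := heq u hu v hv
    rw [surfLap_gaussG hI hJ hr hrs hra hf hg hu hv, gaussG_eq_bivector, ← map_add,
      ← map_smul] at h
    exact Prod.ext_iff.mp (bivector_injective h)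
  have hP : ∀ u ∈ I, ∀ v ∈ J, ∀ w : Fin 3 → ℝ, _ = _ := fun u hu v hv w =>
    congrArg (· ⬝ᵥ w) (hvec u hu v hv).1
  have hQ : ∀ u ∈ I, ∀ v ∈ J, ∀ w : Fin 3 → ℝ, _ = _ := fun u hu v hv w =>
    congrArg (· ⬝ᵥ w) (hvec u hu v hv).2
  simp only [neg_dotProduct, add_dotProduct, sub_dotProduct, smul_dotProduct, Prod.smul_mk,
    Prod.mk_add_mk, smul_eq_mul] at hP hQ
  have hdr : ∀ v ∈ J, d ⬝ᵥ r v = 0 := fun v hv => by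
    simpa [htr v hv, hnr, hlam0 u₀ hu₀ v hv] using hQ u₀ hu₀ v hv (r v)
  have hdt : ∀ v ∈ J, d ⬝ᵥ deriv r v = 0 := fun v hv =>
    ((hr.hasDerivAt_deriv_of_isOpen hJ hv).const_dotProduct_fin_three d).eq_zero_of_eq_const
      hJ hv hdr
  have hdκ : ∀ v ∈ J, sphCurv r v = 0 ∨ d ⬝ᵥ sphN r v = 0 := fun v hv => by
    simpa [hdr v hv] using ((hasDerivAt_deriv_sphere hJ hr hrs hra
      hv).const_dotProduct_fin_three d).eq_zero_of_eq_const hJ hv hdt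
  have hdn' : ∀ v ∈ J, deriv g u₀ / f u₀ ^ 2 * deriv (sphCurv r) v
      = -(lam u₀ v * (d ⬝ᵥ sphN r v)) := fun v hv => by
    have h := hQ u₀ hu₀ v hv (sphN r v)
    simp only [htn, hnn v hv] at h
    linarith
  obtain ⟨e, he⟩ := exists_eq_const_of_hasDerivAt_zero hJ hJiv fun v hv =>
    ((hasDerivAt_sphN hJ hr hrs hra hv).const_dotProduct_fin_three d).congr_deriv
      (by simp [hdt v hv])
  have hdn : ∀ v ∈ J, d ⬝ᵥ sphN r v = 0 := fun v hv => by
    by_contra hne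
    have hκ0 : ∀ w ∈ J, sphCurv r w = 0 := fun w hw =>
      (hdκ w hw).resolve_right (by rwa [he w hw, ← he v hv])
    have h := hdn' v hv
    rw [(hasDerivAt_sphCurv hJ hr hrs hra hv).eq_zero_of_eq_const hJ hv hκ0] at h
    simp [hlam0 u₀ hu₀ v hv, hne] at h
  have hd0 : d = 0 := by
    rw [hexp v₀ hv₀ d, hdr v₀ hv₀, hdt v₀ hv₀, hdn v₀ hv₀]; simp
  have hκ' : ∀ v ∈ J, deriv (sphCurv r) v = 0 := fun v hv => by
    simpa [hdn v hv, hg' u₀ hu₀, hf0 u₀ hu₀] using hdn' v hv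
  obtain ⟨k, hk⟩ := exists_eq_const_of_hasDerivAt_zero hJ hJiv fun v hv =>
    (hasDerivAt_sphCurv hJ hr hrs hra hv).congr_deriv (hκ' v hv)
  have hbt : ∀ v ∈ J, b ⬝ᵥ deriv r v = 0 := fun v hv => by
    simpa [hrt v hv, hnt, hκ' v hv, hlam0 u₀ hu₀ v hv] using hP u₀ hu₀ v hv (deriv r v)
  obtain ⟨c, hc⟩ := exists_eq_const_of_hasDerivAt_zero hJ hJiv fun v hv =>
    ((hasDerivAt_sphN hJ hr hrs hra hv).const_dotProduct_fin_three b).congr_deriv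
      (by simp [hbt v hv])
  have hbr : ∀ v ∈ J, b ⬝ᵥ r v = k * c := fun v hv => by
    have h := ((hasDerivAt_deriv_sphere hJ hr hrs hra
      hv).const_dotProduct_fin_three b).eq_zero_of_eq_const hJ hv hbt
    simp only [dotProduct_add, dotProduct_neg, dotProduct_smul, hc v hv, hk v hv,
      smul_eq_mul] at h
    linarith
  refine ⟨k, c, fun hc0 => hC0 ?_, hk, fun u hu v hv => ⟨?_, ?_, ?_⟩⟩
  · have hb0 : b = 0 := by
      rw [hexp v₀ hv₀ b, hbr v₀ hv₀, hbt v₀ hv₀, hc v₀ hv₀, hc0]; simp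
    rw [hb0, hd0]
    exact map_zero _
  · have h := hP u hu v hv (r v)
    simp only [hnr, htr v hv, hrs v hv, hbr v hv, hk v hv] at h
    linarith
  · have h := hP u hu v hv (sphN r v)
    simp only [hrn, htn, hnn v hv, hc v hv, hk v hv] at h
    linarith
  · have h := hQ u hu v hv (deriv r v)
    simp only [hnt, hra v hv, hdt v hv, hk v hv] at h
    linarith

section Meridian

variable {I : Set ℝ} {f g mu : ℝ → ℝ} {k c : ℝ}

theorem hasDerivAt_deriv_of_contDiffOn (hI : IsOpen I) (hf : ContDiffOn ℝ (⊤ : ℕ∞) f I) {u : ℝ}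
    (hu : u ∈ I) : HasDerivAt (deriv f) (deriv (deriv f) u) u :=
  (hf.deriv_top_of_isOpen hI).hasDerivAt_deriv_of_isOpen hI hu

theorem hasDerivAt_deriv_deriv_of_contDiffOn (hI : IsOpen I) (hf : ContDiffOn ℝ (⊤ : ℕ∞) f I)
    {u : ℝ} (hu : u ∈ I) : HasDerivAt (deriv (deriv f)) (deriv (deriv (deriv f)) u) u :=
  hasDerivAt_deriv_of_contDiffOn hI (hf.deriv_top_of_isOpen hI) hu

theorem deriv_mul_deriv_deriv_add_eq_zero (hI : IsOpen I)
    (hf : ContDiffOn ℝ (⊤ : ℕ∞) f I) (hg : ContDiffOn ℝ (⊤ : ℕ∞) g I)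
    (hfg : ∀ u ∈ I, deriv f u ^ 2 + deriv g u ^ 2 = 1) {u : ℝ} (hu : u ∈ I) :
    deriv f u * deriv (deriv f) u + deriv g u * deriv (deriv g) u = 0 := by
  have h := (((hasDerivAt_deriv_of_contDiffOn hI hf hu).pow 2).add
    ((hasDerivAt_deriv_of_contDiffOn hI hg hu).pow 2)).eq_zero_of_eq_const hI hu hfg
  norm_num at h
  linarith

theorem merCurv_sq_eq_neg (hI : IsOpen I)
    (hf : ContDiffOn ℝ (⊤ : ℕ∞) f I) (hg : ContDiffOn ℝ (⊤ : ℕ∞) g I)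
    (hfg : ∀ u ∈ I, deriv f u ^ 2 + deriv g u ^ 2 = 1) {u : ℝ} (hu : u ∈ I) :
    merCurv f g u ^ 2 = -(deriv f u * deriv (deriv (deriv f)) u
      + deriv g u * deriv (deriv (deriv g)) u) := by
  have h₁ := deriv_mul_deriv_deriv_add_eq_zero hI hf hg hfg hu
  have hf₂ := hasDerivAt_deriv_of_contDiffOn hI hf hu
  have hg₂ := hasDerivAt_deriv_of_contDiffOn hI hg hu
  have h₂ := ((hf₂.mul (hasDerivAt_deriv_deriv_of_contDiffOn hI hf hu)).add
    (hg₂.mul (hasDerivAt_deriv_deriv_of_contDiffOn hI hg hu))).eq_zero_of_eq_const hI hu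
    fun _ => deriv_mul_deriv_deriv_add_eq_zero hI hf hg hfg
  rw [merCurv]
  linear_combination (deriv (deriv f) u ^ 2 + deriv (deriv g) u ^ 2) * hfg u hu + h₂
    - (deriv f u * deriv (deriv f) u + deriv g u * deriv (deriv g) u) * h₁

theorem hasDerivAt_merCurv (hI : IsOpen I)
    (hf : ContDiffOn ℝ (⊤ : ℕ∞) f I) (hg : ContDiffOn ℝ (⊤ : ℕ∞) g I) {u : ℝ} (hu : u ∈ I) :
    HasDerivAt (merCurv f g) (deriv f u * deriv (deriv (deriv g)) u
      - deriv g u * deriv (deriv (deriv f)) u) u := by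
  refine (((hasDerivAt_deriv_of_contDiffOn hI hf hu).mul
    (hasDerivAt_deriv_deriv_of_contDiffOn hI hg hu)).sub
    ((hasDerivAt_deriv_of_contDiffOn hI hg hu).mul
      (hasDerivAt_deriv_deriv_of_contDiffOn hI hf hu))).congr_deriv ?_
  ring

/-- If `κ ≠ 0`, the frame equations force `deriv f` to be constant. -/
theorem exists_deriv_eq_const_of_frame_equations (hI : IsOpen I)
    (hIiv : I.OrdConnected) (hk : k ≠ 0)
    (hf : ContDiffOn ℝ (⊤ : ℕ∞) f I) (hg : ContDiffOn ℝ (⊤ : ℕ∞) g I)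
    (hf0 : ∀ u ∈ I, f u ≠ 0) (hfg : ∀ u ∈ I, deriv f u ^ 2 + deriv g u ^ 2 = 1)
    (hE₁ : ∀ u ∈ I, -(deriv f u / f u ^ 2 * k) = mu u * (k * c))
    (hE₂ : ∀ u ∈ I, -(deriv (deriv (deriv f)) u + deriv f u / f u * deriv (deriv f) u
        - deriv f u / f u ^ 2 * k ^ 2) = mu u * (deriv f u + c))
    (hE₃ : ∀ u ∈ I, -(deriv (deriv (deriv g)) u + deriv f u / f u * deriv (deriv g) u
        - deriv g u / f u ^ 2 * (1 + k ^ 2)) = mu u * deriv g u) :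
    ∃ a, ∀ u ∈ I, deriv f u = a := by
  have e₁ : ∀ u ∈ I, mu u * c * f u ^ 2 = -deriv f u := fun u hu => by
    have h := hE₁ u hu
    have := hf0 u hu
    field_simp at h
    linarith
  have e₂ : ∀ u ∈ I, f u ^ 2 * deriv (deriv (deriv f)) u + f u * deriv f u * deriv (deriv f) u
      = deriv f u * (1 + k ^ 2) - mu u * f u ^ 2 * deriv f u := fun u hu => by
    have h := hE₂ u hu
    have := hf0 u hu
    field_simp at h
    linear_combination -h - e₁ u hu
  have e₃ : ∀ u ∈ I, f u ^ 2 * deriv (deriv (deriv g)) u + f u * deriv f u * deriv (deriv g) u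
      = deriv g u * (1 + k ^ 2) - mu u * f u ^ 2 * deriv g u := fun u hu => by
    have h := hE₃ u hu
    have := hf0 u hu
    field_simp at h
    linear_combination -h
  obtain ⟨K, hK⟩ := exists_eq_const_of_hasDerivAt_zero hI hIiv fun u hu =>
    ((hf.hasDerivAt_deriv_of_isOpen hI hu).mul
      (hasDerivAt_merCurv hI hf hg hu)).congr_deriv (by
        refine mul_left_cancel₀ (hf0 u hu) ?_
        rw [merCurv]
        linear_combination deriv f u * e₃ u hu - deriv g u * e₂ u hu)
  refine ⟨-c * (1 + k ^ 2 + K ^ 2), fun u hu => ?_⟩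
  have h := merCurv_sq_eq_neg hI hf hg hfg hu
  have hKu : f u * merCurv f g u = K := hK u hu
  have h₁ := deriv_mul_deriv_deriv_add_eq_zero hI hf hg hfg hu
  rw [← hKu]
  linear_combination c * f u ^ 2 * h - c * deriv f u * e₂ u hu - c * deriv g u * e₃ u hu
    + c * f u * deriv f u * h₁ + e₁ u hu
    - c * (1 + k ^ 2 - mu u * f u ^ 2) * hfg u hu

theorem exists_eq_linear_of_deriv_eq_const (hI : IsOpen I) (hIiv : I.OrdConnected)
    (hf : ContDiffOn ℝ (⊤ : ℕ∞) f I) {a : ℝ} (ha : ∀ u ∈ I, deriv f u = a) :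
    ∃ a₁, ∀ u ∈ I, f u = a * u + a₁ := by
  obtain ⟨a₁, h⟩ := exists_eq_const_of_hasDerivAt_zero hI hIiv fun u hu =>
    ((hf.hasDerivAt_deriv_of_isOpen hI hu).sub ((hasDerivAt_id u).const_mul a)).congr_deriv
      (by simp [ha u hu])
  refine ⟨a₁, fun u hu => ?_⟩
  have := h u hu
  simp only [Pi.sub_apply, id] at this
  linarith

/-- If `κ = 0`, the frame equations identify the quotient in the differential equation for `f`
with a constant multiple of `|deriv g|`. -/
theorem quotient_eq_of_frame_equations (hI : IsOpen I) (hf : ContDiffOn ℝ (⊤ : ℕ∞) f I)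
    (hg : ContDiffOn ℝ (⊤ : ℕ∞) g I) (hf0 : ∀ u ∈ I, f u ≠ 0)
    (hfg : ∀ u ∈ I, deriv f u ^ 2 + deriv g u ^ 2 = 1) (hg' : ∀ u ∈ I, deriv g u ≠ 0)
    {s : ℝ} (hs : s ∈ I) {m : ℝ} (hm : m ≠ 0)
    (hE₂ : -(deriv (deriv (deriv f)) s + deriv f s / f s * deriv (deriv f) s)
      = m * (deriv f s + c))
    (hE₃ : -(deriv (deriv (deriv g)) s + deriv f s / f s * deriv (deriv g) s
        - deriv g s / f s ^ 2) = m * deriv g s) :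
    (-Real.sqrt (1 - deriv f s ^ 2) *
        (f s * (1 - deriv f s ^ 2) * deriv (fun w => f w * deriv (deriv f) w) s
          + f s ^ 2 * deriv f s * deriv (deriv f) s ^ 2
          + deriv f s * (1 - deriv f s ^ 2) ^ 2)) /
      (f s * deriv f s * deriv (fun w => f w * deriv (deriv f) w) s * (1 - deriv f s ^ 2)
        + f s ^ 2 * deriv (deriv f) s ^ 2 + (1 - deriv f s ^ 2) ^ 2) = c * |deriv g s| := by
  have hd : deriv (fun w => f w * deriv (deriv f) w) s
      = deriv f s * deriv (deriv f) s + f s * deriv (deriv (deriv f)) s :=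
    ((hf.hasDerivAt_deriv_of_isOpen hI hs).mul
      (hasDerivAt_deriv_deriv_of_contDiffOn hI hf hs)).deriv
  have hq : 1 - deriv f s ^ 2 = deriv g s ^ 2 := by linarith [hfg s hs]
  rw [hd, hq, Real.sqrt_sq_eq_abs]
  have h₁ := deriv_mul_deriv_deriv_add_eq_zero hI hf hg hfg hs
  have h₂ := merCurv_sq_eq_neg hI hf hg hfg hs
  have hφ : deriv (deriv f) s = -merCurv f g s * deriv g s := by
    rw [merCurv]
    linear_combination (-deriv (deriv f) s) * hfg s hs + deriv f s * h₁
  have hf0s := hf0 s hs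
  have e₂ : f s * (deriv f s * deriv (deriv f) s + f s * deriv (deriv (deriv f)) s)
      = -m * f s ^ 2 * (deriv f s + c) := by
    field_simp at hE₂
    linear_combination -f s * hE₂
  have e₃ : f s ^ 2 * deriv (deriv (deriv g)) s + f s * deriv f s * deriv (deriv g) s
      = deriv g s - m * f s ^ 2 * deriv g s := by
    field_simp at hE₃
    linear_combination -hE₃
  have h₃ : f s ^ 2 * merCurv f g s ^ 2 + deriv g s ^ 2 = f s ^ 2 * m * (1 + c * deriv f s) := by
    linear_combination f s ^ 2 * h₂ - deriv f s * e₂ - deriv g s * e₃ + f s * deriv f s * h₁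
      + m * f s ^ 2 * hfg s hs
  have hN : f s * deriv g s ^ 2 * (deriv f s * deriv (deriv f) s
        + f s * deriv (deriv (deriv f)) s)
      + f s ^ 2 * deriv f s * deriv (deriv f) s ^ 2 + deriv f s * (deriv g s ^ 2) ^ 2
      = -(m * c * f s ^ 2 * deriv g s ^ 4) := by
    linear_combination deriv g s ^ 2 * e₂
      + f s ^ 2 * deriv f s * (deriv (deriv f) s - merCurv f g s * deriv g s) * hφ
      + deriv f s * deriv g s ^ 2 * h₃ + m * c * f s ^ 2 * deriv g s ^ 2 * hfg s hs
  have hD : f s * deriv f s * (deriv f s * deriv (deriv f) s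
        + f s * deriv (deriv (deriv f)) s) * deriv g s ^ 2
      + f s ^ 2 * deriv (deriv f) s ^ 2 + (deriv g s ^ 2) ^ 2
      = m * f s ^ 2 * deriv g s ^ 4 := by
    linear_combination deriv f s * deriv g s ^ 2 * e₂
      + f s ^ 2 * (deriv (deriv f) s - merCurv f g s * deriv g s) * hφ
      + deriv g s ^ 2 * h₃ - m * f s ^ 2 * deriv g s ^ 2 * hfg s hs
  rw [hN, hD]
  have := hg' s hs
  field_simp

end Meridian

/-- For `g′ ≠ 0` everywhere: if the meridian surface has pointwise
1-type Gauss map of the second kind, then either (i) `κ` is constant, `κ_α ≡ 0` and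
`f(u) = au + a₁`, `g(u) = bu + b₁` with `a² + b² = 1`, `a ≠ 0`, `b ≠ 0`, or (ii) `κ ≡ 0`
and `f` satisfies the differential equation
`(ln[−√(1−f′²)(f(1−f′²)(ff″)′ + f²f′f″² + f′(1−f′²)²) /
     (ff′(ff″)′(1−f′²) + f²f″² + (1−f′²)²)])′ = −f′f″/(1−f′²)`. -/
theorem meridian_surface_second_kind_necessary_of_g_deriv_ne_zero
    (I J : Set ℝ) (hI : IsOpen I) (hIiv : I.OrdConnected) (hIne : I.Nonempty)
    (hJ : IsOpen J) (hJiv : J.OrdConnected) (hJne : J.Nonempty)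
    (r : ℝ → Fin 3 → ℝ) (hr : ContDiffOn ℝ (⊤ : ℕ∞) r J)
    (hrs : ∀ v ∈ J, r v ⬝ᵥ r v = 1) (hra : ∀ v ∈ J, deriv r v ⬝ᵥ deriv r v = 1)
    (f g : ℝ → ℝ) (hf : ContDiffOn ℝ (⊤ : ℕ∞) f I) (hg : ContDiffOn ℝ (⊤ : ℕ∞) g I)
    (hf0 : ∀ u ∈ I, f u ≠ 0) (hfg : ∀ u ∈ I, deriv f u ^ 2 + deriv g u ^ 2 = 1)
    (hg' : ∀ u ∈ I, deriv g u ≠ 0)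
    (lam : ℝ → ℝ → ℝ) (hlam : ContDiffOn ℝ (⊤ : ℕ∞) (Function.uncurry lam) (I ×ˢ J))
    (hlam0 : ∀ u ∈ I, ∀ v ∈ J, lam u v ≠ 0)
    (C : Fin 4 → Fin 4 → ℝ) (hCskew : ∀ i j, C i j = -C j i) (hC0 : C ≠ 0)
    (heq : ∀ u ∈ I, ∀ v ∈ J,
      surfLap f (gaussG f g r) u v = lam u v • (gaussG f g r u v + C)) :
    ((∃ κ₀ : ℝ, ∀ v ∈ J, sphCurv r v = κ₀) ∧ (∀ u ∈ I, merCurv f g u = 0) ∧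
      ∃ a a₁ b b₁ : ℝ, a ^ 2 + b ^ 2 = 1 ∧ a ≠ 0 ∧ b ≠ 0 ∧
        (∀ u ∈ I, f u = a * u + a₁) ∧ ∀ u ∈ I, g u = b * u + b₁) ∨
    ((∀ v ∈ J, sphCurv r v = 0) ∧
      ∀ u ∈ I,
        deriv (fun s => Real.log
          ((-Real.sqrt (1 - deriv f s ^ 2) *
              (f s * (1 - deriv f s ^ 2) * deriv (fun w => f w * deriv (deriv f) w) s
                + f s ^ 2 * deriv f s * deriv (deriv f) s ^ 2
                + deriv f s * (1 - deriv f s ^ 2) ^ 2)) /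
            (f s * deriv f s * deriv (fun w => f w * deriv (deriv f) w) s * (1 - deriv f s ^ 2)
              + f s ^ 2 * deriv (deriv f) s ^ 2 + (1 - deriv f s ^ 2) ^ 2))) u
          = -(deriv f u * deriv (deriv f) u) / (1 - deriv f u ^ 2)) := by
  obtain ⟨v₀, hv₀⟩ := hJne
  obtain ⟨k, c, hc, hk, hE⟩ := exists_frame_equations hI hIne hJ hJiv ⟨v₀, hv₀⟩ hr hrs hra hf hg
    hf0 hg' hlam0 hCskew hC0 heq
  by_cases hk0 : k = 0
  · subst hk0
    refine Or.inr ⟨hk, fun u hu => ?_⟩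
    have hev := Filter.eventually_of_mem (hI.mem_nhds hu) fun s hs =>
      congrArg Real.log (quotient_eq_of_frame_equations (c := c) hI hf hg hf0 hfg hg' hs
        (hlam0 s hs v₀ hv₀) (by simpa using (hE s hs v₀ hv₀).2.1)
        (by simpa using (hE s hs v₀ hv₀).2.2))
    have hlog : (fun s => Real.log (c * |deriv g s|)) =ᶠ[nhds u]
        fun s => Real.log c + Real.log (deriv g s) :=
      Filter.eventually_of_mem (hI.mem_nhds hu) fun s hs => by
        simp only [Real.log_mul hc (abs_ne_zero.mpr (hg' s hs)), Real.log_abs]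
    rw [Filter.EventuallyEq.deriv_eq (Filter.EventuallyEq.trans hev hlog),
      (((hasDerivAt_deriv_of_contDiffOn hI hg hu).log (hg' u hu)).const_add _).deriv,
      show 1 - deriv f u ^ 2 = deriv g u ^ 2 by linarith [hfg u hu]]
    have := hg' u hu
    field_simp
    linear_combination deriv_mul_deriv_deriv_add_eq_zero hI hf hg hfg hu
  · obtain ⟨a, ha⟩ := exists_deriv_eq_const_of_frame_equations (mu := fun u => lam u v₀) hI hIiv
      hk0 hf hg hf0 hfg (fun u hu => (hE u hu v₀ hv₀).1) (fun u hu => (hE u hu v₀ hv₀).2.1)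
      fun u hu => (hE u hu v₀ hv₀).2.2
    have hf₂ : ∀ u ∈ I, deriv (deriv f) u = 0 := fun u hu =>
      (hasDerivAt_deriv_of_contDiffOn hI hf hu).eq_zero_of_eq_const hI hu ha
    have hg₂ : ∀ u ∈ I, deriv (deriv g) u = 0 := fun u hu => by
      simpa [hf₂ u hu, hg' u hu] using deriv_mul_deriv_deriv_add_eq_zero hI hf hg hfg hu
    obtain ⟨b, hb⟩ := exists_eq_const_of_hasDerivAt_zero hI hIiv fun u hu =>
      (hasDerivAt_deriv_of_contDiffOn hI hg hu).congr_deriv (hg₂ u hu)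
    obtain ⟨a₁, ha₁⟩ := exists_eq_linear_of_deriv_eq_const hI hIiv hf ha
    obtain ⟨b₁, hb₁⟩ := exists_eq_linear_of_deriv_eq_const hI hIiv hg hb
    obtain ⟨u₀, hu₀⟩ := hIne
    refine Or.inl ⟨⟨k, hk⟩, fun u hu => by simp [merCurv, hf₂ u hu, hg₂ u hu], a, a₁, b, b₁,
      ?_, fun ha0 => ?_, ?_, ha₁, hb₁⟩
    · rw [← ha u₀ hu₀, ← hb u₀ hu₀, hfg u₀ hu₀]
    · simpa [ha u₀ hu₀, ha0, hk0, hc, hlam0 u₀ hu₀ v₀ hv₀] using (hE u₀ hu₀ v₀ hv₀).1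
    · exact hb u₀ hu₀ ▸ hg' u₀ hu₀
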